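/- Let Γ be a discrete abelian group and A, B ⊆ Γ nonempty. If there exists an invariant mean m on ℓ^∞(Γ) with m(A+B) < m(A) + m(B), then d*(A+B) < d*(A) + d*(B). -/

import Mathlib

open scoped Pointwise
open Filter

namespace SumsetMeans

variable (Γ : Type*) [AddCommGroup Γ] [TopologicalSpace Γ] [DiscreteTopology Γ]

/-- The indicator function of `A ⊆ Γ` as a bounded (continuous, since `Γ` is discrete)
real-valued function, i.e. as an element of `ℓ^∞(Γ)`. -/
noncomputable def ind (A : Set Γ) : BoundedContinuousFunction Γ ℝ :=
  BoundedContinuousFunction.ofNormedAddCommGroup (Set.indicator A 1)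
    continuous_of_discreteTopology 1
    (fun x => by by_cases h : x ∈ A <;> simp [Set.indicator_apply, h])

/-- The translate `τ_γ f`, given by `(τ_γ f)(x) = f (x - γ)`. -/
noncomputable def translate (γ : Γ) (f : BoundedContinuousFunction Γ ℝ) :
    BoundedContinuousFunction Γ ℝ :=
  f.compContinuous ⟨fun x => x - γ, continuous_of_discreteTopology⟩

/-- An invariant mean on `ℓ^∞(Γ)`: a linear functional with `m 1 = 1`, nonnegative on
nonnegative functions, and invariant under all translations. -/
structure IsInvariantMean (m : BoundedContinuousFunction Γ ℝ →ₗ[ℝ] ℝ) : Prop where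
  map_one : m 1 = 1
  nonneg : ∀ f : BoundedContinuousFunction Γ ℝ, (∀ x, 0 ≤ f x) → 0 ≤ m f
  invariant : ∀ (γ : Γ) (f : BoundedContinuousFunction Γ ℝ), m (translate Γ γ f) = m f

/-- The value `m(A) := m(1_A)` of a mean on a set `A ⊆ Γ`. -/
noncomputable def mVal (m : BoundedContinuousFunction Γ ℝ →ₗ[ℝ] ℝ) (A : Set Γ) : ℝ :=
  m (ind Γ A)

/-- Upper Banach density: `d*(A) = sup { m(A) : m an invariant mean on ℓ^∞(Γ) }`. -/
noncomputable def ubd (A : Set Γ) : ℝ :=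
  sSup {x : ℝ | ∃ m, IsInvariantMean Γ m ∧ mVal Γ m A = x}

/-- An extreme invariant mean: an extreme point of the convex set of invariant means. -/
def IsExtremeInvariantMean (ν : BoundedContinuousFunction Γ ℝ →ₗ[ℝ] ℝ) : Prop :=
  ν ∈ Set.extremePoints ℝ {m : BoundedContinuousFunction Γ ℝ →ₗ[ℝ] ℝ | IsInvariantMean Γ m}

section Helpers

variable {Γ}

omit [AddCommGroup Γ] in
@[simp]
lemma ind_apply (A : Set Γ) (x : Γ) [Decidable (x ∈ A)] : ind Γ A x = if x ∈ A then 1 else 0 := by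
  simp [ind, Set.indicator_apply]

lemma ind_nonneg (A : Set Γ) (x : Γ) : 0 ≤ ind Γ A x := by
  classical
  rw [ind_apply]; split_ifs <;> norm_num

lemma ind_le_one (A : Set Γ) (x : Γ) : ind Γ A x ≤ 1 := by
  classical
  rw [ind_apply]; split_ifs <;> norm_num

@[simp]
lemma translate_apply (γ : Γ) (f : BoundedContinuousFunction Γ ℝ) (x : Γ) :
    translate Γ γ f x = f (x - γ) := rfl

namespace IsInvariantMean

variable {m : BoundedContinuousFunction Γ ℝ →ₗ[ℝ] ℝ} (hm : IsInvariantMean Γ m)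
include hm

lemma mono {f g : BoundedContinuousFunction Γ ℝ} (h : ∀ x, f x ≤ g x) : m f ≤ m g := by
  have := hm.nonneg (g - f) (fun x => by simpa using h x)
  rw [map_sub] at this
  linarith

lemma abs_le (f : BoundedContinuousFunction Γ ℝ) : |m f| ≤ ‖f‖ := by
  have h1 : m f ≤ m (‖f‖ • 1) := hm.mono (fun x => by
    simpa using (le_abs_self _).trans (f.norm_coe_le_norm x))
  have h2 : m (-(‖f‖ • 1)) ≤ m f := hm.mono (fun x => by
    simpa using neg_le_of_abs_le (f.norm_coe_le_norm x))
  simp only [map_neg, map_smul, hm.map_one, smul_eq_mul, mul_one] at h1 h2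
  exact _root_.abs_le.2 ⟨h2, h1⟩

lemma mVal_nonneg (A : Set Γ) : 0 ≤ mVal Γ m A := hm.nonneg _ (ind_nonneg A)

lemma mVal_le_one (A : Set Γ) : mVal Γ m A ≤ 1 := by
  rw [← hm.map_one]
  exact hm.mono (ind_le_one A)

lemma mVal_univ : mVal Γ m Set.univ = 1 := by
  classical
  rw [← hm.map_one, mVal]
  congr 1
  ext x
  simp

lemma mVal_mono {A B : Set Γ} (h : A ⊆ B) : mVal Γ m A ≤ mVal Γ m B := by
  classical
  refine hm.mono fun x => ?_
  rw [ind_apply, ind_apply]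
  split_ifs with h1 h2 <;> first | exact absurd (h h1) h2 | norm_num

lemma mVal_union_add_inter (A B : Set Γ) :
    mVal Γ m (A ∪ B) + mVal Γ m (A ∩ B) = mVal Γ m A + mVal Γ m B := by
  classical
  simp only [mVal, ← map_add]
  congr 1
  ext x
  by_cases h1 : x ∈ A <;> by_cases h2 : x ∈ B <;> simp [h1, h2]

lemma mVal_empty : mVal Γ m ∅ = 0 := by
  classical
  rw [mVal, ← map_zero m]
  congr 1
  ext x
  simp

lemma mVal_union_le (A B : Set Γ) : mVal Γ m (A ∪ B) ≤ mVal Γ m A + mVal Γ m B := by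
  linarith [hm.mVal_union_add_inter A B, hm.mVal_nonneg (A ∩ B)]

lemma mVal_le_add {A B C : Set Γ} (h : A ⊆ B ∪ C) : mVal Γ m A ≤ mVal Γ m B + mVal Γ m C :=
  (hm.mVal_mono h).trans (hm.mVal_union_le B C)

lemma mVal_inter_add_diff (A B : Set Γ) :
    mVal Γ m (A ∩ B) + mVal Γ m (A \ B) = mVal Γ m A := by
  have h := hm.mVal_union_add_inter (A ∩ B) (A \ B)
  have h2 : A ∩ B ∩ (A \ B) = ∅ := by ext x; simp; tauto
  rw [Set.inter_union_sdiff, h2, hm.mVal_empty] at h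
  linarith

lemma mVal_shift (A : Set Γ) (γ : Γ) : mVal Γ m {x | x + γ ∈ A} = mVal Γ m A := by
  classical
  rw [mVal, mVal, ← hm.invariant (-γ) (ind Γ A)]
  congr 1
  ext x
  simp

/-- Finite additivity of a mean along the fibres of a map to a finite type. -/
lemma mVal_eq_sum_fiber {ι : Type*} [Fintype ι] (f : Γ → ι) (A : Set Γ) :
    mVal Γ m A = ∑ i, mVal Γ m {x | x ∈ A ∧ f x = i} := by
  classical
  simp only [mVal, ← map_sum]
  congr 1
  ext x
  by_cases h : x ∈ A <;> simp [BoundedContinuousFunction.coe_sum, h]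

end IsInvariantMean

/-- `γ ↦ m(h · τ_{-γ} f)` as a bounded function. -/
noncomputable def corr (m : BoundedContinuousFunction Γ ℝ →ₗ[ℝ] ℝ) (hm : IsInvariantMean Γ m)
    (f : BoundedContinuousFunction Γ ℝ) (h : BoundedContinuousFunction Γ ℝ) :
    BoundedContinuousFunction Γ ℝ :=
  BoundedContinuousFunction.ofNormedAddCommGroup (fun γ => m (h * translate Γ (-γ) f))
    continuous_of_discreteTopology (‖h‖ * ‖f‖) (fun γ => by
      refine (hm.abs_le _).trans ((norm_mul_le _ _).trans ?_)
      gcongr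
      exact (BoundedContinuousFunction.norm_le (norm_nonneg _)).2
        fun x => f.norm_coe_le_norm _)

lemma corr_apply {m : BoundedContinuousFunction Γ ℝ →ₗ[ℝ] ℝ} (hm : IsInvariantMean Γ m)
    (f h : BoundedContinuousFunction Γ ℝ) (γ : Γ) :
    corr m hm f h γ = m (h * translate Γ (-γ) f) := rfl

lemma corr_ind_apply {m : BoundedContinuousFunction Γ ℝ →ₗ[ℝ] ℝ} (hm : IsInvariantMean Γ m)
    (A B : Set Γ) (γ : Γ) :
    corr m hm (ind Γ A) (ind Γ B) γ = mVal Γ m {x | x ∈ B ∧ x + γ ∈ A} := by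
  classical
  rw [corr_apply, mVal]
  congr 1
  ext x
  by_cases h1 : x ∈ B <;> by_cases h2 : x + γ ∈ A <;> simp [h1, h2]

/-- The functional `h ↦ m_γ(m(h · τ_{-γ} f))`. -/
noncomputable def corrMean (m : BoundedContinuousFunction Γ ℝ →ₗ[ℝ] ℝ)
    (hm : IsInvariantMean Γ m) (f : BoundedContinuousFunction Γ ℝ) :
    BoundedContinuousFunction Γ ℝ →ₗ[ℝ] ℝ where
  toFun h := m (corr m hm f h)
  map_add' h k := by
    rw [← map_add]
    congr 1
    ext γ
    simp [corr_apply, add_mul]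
  map_smul' c h := by
    rw [RingHom.id_apply, ← map_smul]
    congr 1
    ext γ
    simp only [corr_apply, smul_mul_assoc, map_smul, BoundedContinuousFunction.coe_smul]

/-- For an extreme invariant mean, correlations average to the product of the means. -/
lemma IsExtremeInvariantMean.mean_corr {m : BoundedContinuousFunction Γ ℝ →ₗ[ℝ] ℝ}
    (hm : IsInvariantMean Γ m) (he : IsExtremeInvariantMean Γ m) (A B : Set Γ) :
    m (corr m hm (ind Γ A) (ind Γ B)) = mVal Γ m A * mVal Γ m B := by
  set f := ind Γ A with hf
  set t := mVal Γ m A with ht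
  have h0 : ∀ h : BoundedContinuousFunction Γ ℝ, (∀ x, 0 ≤ h x) → 0 ≤ corrMean m hm f h :=
    fun h hh => hm.nonneg _ fun γ => hm.nonneg _ fun x =>
      mul_nonneg (hh x) (ind_nonneg A _)
  have h1 : ∀ h : BoundedContinuousFunction Γ ℝ, (∀ x, 0 ≤ h x) → corrMean m hm f h ≤ m h := by
    intro h hh
    have : corrMean m hm f h ≤ m (m h • 1) := by
      refine hm.mono fun γ => ?_
      rw [corr_apply]
      simp only [BoundedContinuousFunction.coe_smul, BoundedContinuousFunction.coe_one,
        Pi.one_apply, smul_eq_mul, mul_one]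
      exact hm.mono fun x => by
        simpa using mul_le_mul_of_nonneg_left (ind_le_one A (x + γ)) (hh x)
    simpa [hm.map_one] using this
  have hone : corrMean m hm f 1 = t := by
    have : corr m hm f 1 = t • 1 := by
      ext γ
      simp [corr_apply, hm.invariant, ht, mVal, hf]
    change m (corr m hm f 1) = t
    rw [this]
    simp [hm.map_one]
  have hinv : ∀ γ h, corrMean m hm f (translate Γ γ h) = corrMean m hm f h := by
    intro γ h
    have : corr m hm f (translate Γ γ h) = translate Γ (-γ) (corr m hm f h) := by
      ext s
      rw [translate_apply, corr_apply, corr_apply, ← hm.invariant γ (h * _)]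
      congr 1
      ext x
      simp
      left
      congr 1
      abel
    change m _ = m _
    rw [this, hm.invariant]
  have ht0 : 0 ≤ t := hm.mVal_nonneg A
  have ht1 : t ≤ 1 := hm.mVal_le_one A
  set d := corrMean m hm f - t • m with hd
  have hp : IsInvariantMean Γ (m + d) := by
    refine ⟨by simp [hd, hone, hm.map_one], fun h hh => ?_, fun γ h => ?_⟩
    · have a := h0 h hh
      have b := hm.nonneg h hh
      simp [hd]
      nlinarith
    · simp [hd, hinv, hm.invariant]
  have hq : IsInvariantMean Γ (m - d) := by
    refine ⟨by simp [hd, hone, hm.map_one], fun h hh => ?_, fun γ h => ?_⟩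
    · have a := h1 h hh
      have b := hm.nonneg h hh
      simp [hd]
      nlinarith
    · simp [hd, hinv, hm.invariant]
  have key : m + d = m := by
    refine (mem_extremePoints.1 he).2 _ hp _ hq ?_ |>.1
    refine ⟨1/2, 1/2, by norm_num, by norm_num, by norm_num, ?_⟩
    module
  have : d (ind Γ B) = 0 := by
    have := congrArg (fun φ => φ (ind Γ B)) key
    simpa using this
  simp only [hd, LinearMap.sub_apply, LinearMap.smul_apply, smul_eq_mul] at this
  change corrMean m hm f (ind Γ B) = t * m (ind Γ B)
  linarith

/-- The mean of the symmetric difference of `A` and `A - γ`. -/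
noncomputable def defect (m : BoundedContinuousFunction Γ ℝ →ₗ[ℝ] ℝ) (A : Set Γ) (γ : Γ) : ℝ :=
  mVal Γ m {x | ¬(x ∈ A ↔ x + γ ∈ A)}

section Defect

variable {m : BoundedContinuousFunction Γ ℝ →ₗ[ℝ] ℝ} (hm : IsInvariantMean Γ m) (A : Set Γ)
include hm

lemma defect_zero : defect m A 0 = 0 := by
  simp [defect, hm.mVal_empty]

lemma defect_neg (γ : Γ) : defect m A (-γ) = defect m A γ := by
  rw [defect, ← hm.mVal_shift _ γ, defect]
  congr 1
  ext x
  simp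
  tauto

lemma defect_add_le (γ γ' : Γ) : defect m A (γ + γ') ≤ defect m A γ + defect m A γ' := by
  have : defect m A γ' = mVal Γ m {x | ¬(x + γ ∈ A ↔ x + γ + γ' ∈ A)} :=
    (hm.mVal_shift _ γ).symm
  rw [this]
  refine hm.mVal_le_add fun x hx => ?_
  simp only [Set.mem_union, Set.mem_ofPred_eq, ← add_assoc] at hx ⊢
  tauto

/-- If almost all of `B + a` lies in `A` for every `a ∈ A`, then large self-overlaps of `B`
are almost periods of `A`. -/
lemma IsExtremeInvariantMean.overlap_mul_defect_le (he : IsExtremeInvariantMean Γ m) {B : Set Γ}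
    {ε : ℝ} (hε : 0 ≤ ε) (hAB : ∀ a ∈ A, mVal Γ m {b | b ∈ B ∧ b + a ∉ A} ≤ ε) (γ : Γ) :
    mVal Γ m {b | b ∈ B ∧ b + γ ∈ B} * defect m A γ ≤ 4 * ε := by
  classical
  rw [defect, mul_comm, ← he.mean_corr hm]
  have hr : ∀ s, mVal Γ m {b | b ∈ B ∧ ¬(b + s ∈ A ↔ s ∈ A)} ≤
      corr m hm (ind Γ A) (ind Γ B) s - mVal Γ m B * ind Γ A s + 2 * ε := by
    intro s
    rw [corr_ind_apply, ind_apply]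
    by_cases hs : s ∈ A
    · have h1 := hm.mVal_inter_add_diff B {b | b + s ∈ A}
      have h2 := hAB s hs
      have h3 : {b | b ∈ B ∧ ¬(b + s ∈ A ↔ s ∈ A)} = {b | b ∈ B ∧ b + s ∉ A} := by
        ext b; simp [hs]
      have h4 : B \ {b | b + s ∈ A} = {b | b ∈ B ∧ b + s ∉ A} := rfl
      have h5 : B ∩ {b | b + s ∈ A} = {b | b ∈ B ∧ b + s ∈ A} := rfl
      rw [h3, if_pos hs]
      rw [h4, h5] at h1
      linarith
    · have h3 : {b | b ∈ B ∧ ¬(b + s ∈ A ↔ s ∈ A)} = {b | b ∈ B ∧ b + s ∈ A} := by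
        ext b; simp [hs]
      rw [h3, if_neg hs]
      linarith
  have hle : m (corr m hm (ind Γ {x | ¬(x ∈ A ↔ x + γ ∈ A)}) (ind Γ {b | b ∈ B ∧ b + γ ∈ B})) ≤
      m ((2 : ℝ) • (corr m hm (ind Γ A) (ind Γ B) - mVal Γ m B • ind Γ A + (2 * ε) • 1)) := by
    refine hm.mono fun s => ?_
    rw [corr_ind_apply]
    have h1 : mVal Γ m {x | x ∈ {b | b ∈ B ∧ b + γ ∈ B} ∧ x + s ∈ {x | ¬(x ∈ A ↔ x + γ ∈ A)}} ≤
        mVal Γ m {b | b ∈ B ∧ ¬(b + s ∈ A ↔ s ∈ A)} +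
        mVal Γ m {x | x + γ ∈ {b | b ∈ B ∧ ¬(b + s ∈ A ↔ s ∈ A)}} := by
      refine hm.mVal_le_add fun x hx => ?_
      simp only [Set.mem_union, Set.mem_ofPred_eq, add_right_comm x γ s] at hx ⊢
      tauto
    rw [hm.mVal_shift] at h1
    have h2 := hr s
    simp only [BoundedContinuousFunction.coe_smul, BoundedContinuousFunction.coe_add,
      BoundedContinuousFunction.coe_sub, Pi.add_apply, Pi.sub_apply, smul_eq_mul,
      BoundedContinuousFunction.coe_one, Pi.one_apply]
    linarith
  refine hle.trans ?_
  simp only [map_smul, map_add, map_sub, hm.map_one, he.mean_corr hm, smul_eq_mul]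
  change 2 * (mVal Γ m A * mVal Γ m B - mVal Γ m B * mVal Γ m A + _) ≤ _
  linarith

/-- Almost invariance of `A` under `H` forces `A` to be almost null or almost full in each
coset of `H`. -/
lemma IsExtremeInvariantMean.coset_dichotomy (he : IsExtremeInvariantMean Γ m)
    {H : AddSubgroup Γ} {η : ℝ} (hη : 0 ≤ η) (hH : ∀ h ∈ H, defect m A h ≤ η) (q : Γ ⧸ H) :
    mVal Γ m {x | x ∉ A ∧ (x : Γ ⧸ H) = q} * mVal Γ m {x | x ∈ A ∧ (x : Γ ⧸ H) = q} ≤ η := by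
  rw [← he.mean_corr hm]
  have : m (corr m hm (ind Γ {x | x ∉ A ∧ (x : Γ ⧸ H) = q})
      (ind Γ {x | x ∈ A ∧ (x : Γ ⧸ H) = q})) ≤ m (η • 1) := by
    refine hm.mono fun s => ?_
    rw [corr_ind_apply]
    simp only [BoundedContinuousFunction.coe_smul, smul_eq_mul,
      BoundedContinuousFunction.coe_one, Pi.one_apply, mul_one]
    by_cases hs : s ∈ H
    · refine (hm.mVal_mono ?_).trans (hH s hs)
      rintro x ⟨⟨h1, -⟩, h2, -⟩
      simp [h1, h2]
    · convert hη
      rw [← hm.mVal_empty]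
      congr 1
      ext x
      simp only [Set.mem_ofPred_eq, Set.mem_empty_iff_false, iff_false, not_and]
      rintro ⟨-, h1⟩ - h2
      rw [QuotientAddGroup.mk_add, h1] at h2
      exact hs ((QuotientAddGroup.eq_zero_iff s).1 (by simpa using h2))
  simpa [hm.map_one] using this

/-- Translates of a set with small pairwise overlaps are few. -/
lemma IsInvariantMean.card_mul_mVal_le {n : ℕ} (f : Fin n → Γ) {κ : ℝ} (hκ : 0 ≤ κ)
    (hf : ∀ i j, i ≠ j → mVal Γ m {x | x ∈ A ∧ x + (f i - f j) ∈ A} ≤ κ) :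
    n * mVal Γ m A ≤ 1 + n ^ 2 * κ := by
  classical
  set g : Fin n → BoundedContinuousFunction Γ ℝ := fun i => ind Γ {x | x + f i ∈ A} with hg
  have hgi : ∀ i, m (g i) = mVal Γ m A := fun i => hm.mVal_shift A (f i)
  have hgij : ∀ i j, m (g i * g j) = mVal Γ m {x | x ∈ A ∧ x + (f i - f j) ∈ A} := by
    intro i j
    rw [← hm.mVal_shift _ (f j), mVal]
    congr 1
    ext x
    by_cases h1 : x + f i ∈ A <;> by_cases h2 : x + f j ∈ A <;> simp [hg, h1, h2]
  have hbound : ∀ i j, m (g i * g j) ≤ κ + if i = j then mVal Γ m A else 0 := by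
    intro i j
    rw [hgij]
    split_ifs with h
    · have := hm.mVal_mono (A := {x | x ∈ A ∧ x + (f i - f j) ∈ A}) (B := A) fun x hx => hx.1
      linarith
    · linarith [hf i j h]
  have hpos : 0 ≤ m ((∑ i, g i - 1) * (∑ i, g i - 1)) :=
    hm.nonneg _ fun x => mul_self_nonneg _
  have hexp : (∑ i, g i - 1) * (∑ i, g i - 1) = ∑ i, ∑ j, g i * g j - (2 : ℝ) • ∑ i, g i + 1 := by
    rw [← Finset.sum_mul_sum, two_smul]
    ring
  have hsum : ∑ i, ∑ j, m (g i * g j) ≤ n ^ 2 * κ + n * mVal Γ m A := by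
    refine (Finset.sum_le_sum fun i _ => Finset.sum_le_sum fun j _ => hbound i j).trans ?_
    simp [Finset.sum_add_distrib]
    linarith
  rw [hexp] at hpos
  simp only [map_add, map_sub, map_sum, map_smul, hgi, hm.map_one, Finset.sum_const,
    Finset.card_univ, Fintype.card_fin, nsmul_eq_mul, smul_eq_mul] at hpos
  linarith

end Defect

omit [TopologicalSpace Γ] [DiscreteTopology Γ] in
/-- A subadditive function with no large separated families is small on a subgroup of small
index. -/
lemma exists_addSubgroup_le_of_separated {ρ : Γ → ℝ} (h0 : ρ 0 = 0) (hneg : ∀ γ, ρ (-γ) = ρ γ)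
    (hadd : ∀ γ γ', ρ (γ + γ') ≤ ρ γ + ρ γ') {n : ℕ} {η : ℝ} (hη : 0 < η)
    (hsep : ∀ f : Fin n → Γ, ∃ i j, i ≠ j ∧ ρ (f i - f j) ≤ η) :
    ∃ H : AddSubgroup Γ, H.index ≠ 0 ∧ H.index ≤ n ∧ ∀ h ∈ H, ρ h ≤ 4 ^ n * η := by
  obtain ⟨i, hi⟩ : ∃ i : Fin n, ∀ γ, ρ γ ≤ 2 * (4 ^ (i : ℕ) * η) → ρ γ ≤ 4 ^ (i : ℕ) * η := by
    by_contra! hcon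
    choose f hf1 hf2 using hcon
    have key : ∀ i j : Fin n, j < i → η < ρ (f i - f j) := by
      intro i j hij
      have h1 := hadd (f i - f j) (f j)
      rw [sub_add_cancel] at h1
      have h2 : (4 : ℝ) ^ ((j : ℕ) + 1) ≤ 4 ^ (i : ℕ) := pow_le_pow_right₀ (by norm_num) hij
      have h3 : (1 : ℝ) ≤ 4 ^ (j : ℕ) := one_le_pow₀ (by norm_num)
      rw [pow_succ] at h2
      nlinarith [hf1 j, hf2 i]
    obtain ⟨i, j, hij, h⟩ := hsep f
    rcases lt_or_gt_of_ne hij with hlt | hlt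
    · have := key j i hlt
      rw [← hneg, neg_sub] at this
      linarith
    · linarith [key i j hlt]
  have h1 : (1 : ℝ) ≤ 4 ^ (i : ℕ) := one_le_pow₀ (by norm_num)
  let H : AddSubgroup Γ :=
    { carrier := {γ | ρ γ ≤ 4 ^ (i : ℕ) * η}
      add_mem' := fun {a b} ha hb => hi _ (by
        simp only [Set.mem_ofPred_eq] at ha hb
        linarith [hadd a b])
      zero_mem' := by
        simp only [Set.mem_ofPred_eq, h0]
        positivity
      neg_mem' := fun {a} ha => by simpa [hneg] using ha }
  have hinj : ∀ f : Fin n → Γ ⧸ H, ¬ Function.Injective f := by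
    intro f hf
    obtain ⟨a, b, hab, h⟩ := hsep fun k => (f k).out
    refine hab (hf ?_)
    rw [← QuotientAddGroup.out_eq' (f a), ← QuotientAddGroup.out_eq' (f b), eq_comm,
      QuotientAddGroup.eq]
    change ρ _ ≤ _
    rw [neg_add_eq_sub]
    nlinarith
  have hfin : Finite (Γ ⧸ H) := by
    by_contra hinf
    rw [not_finite_iff_infinite] at hinf
    exact hinj (fun k => Infinite.natEmbedding (Γ ⧸ H) k)
      ((Infinite.natEmbedding _).injective.comp Fin.val_injective)
  refine ⟨H, ?_, ?_, fun h hh => le_trans hh ?_⟩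
  · rw [AddSubgroup.index]
    exact Nat.card_pos.ne'
  · by_contra! hlt
    rw [AddSubgroup.index] at hlt
    exact hinj (fun k => (Finite.equivFin (Γ ⧸ H)).symm (Fin.castLE hlt.le k))
      ((Finite.equivFin (Γ ⧸ H)).symm.injective.comp (Fin.castLE_injective _))
  · gcongr
    · norm_num
    · exact i.2.le

section Local

variable {m : BoundedContinuousFunction Γ ℝ →ₗ[ℝ] ℝ} (hm : IsInvariantMean Γ m)
include hm

/-- If almost all of `B + a` lies in `A` for every `a ∈ A`, then `A` is almost invariant under a
subgroup of small index. -/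
lemma IsExtremeInvariantMean.exists_almost_period (he : IsExtremeInvariantMean Γ m)
    {A B : Set Γ} {δ η : ℝ} (hη : 0 < η) {n : ℕ} (hn : 2 ≤ n * δ) (hn0 : 0 < n)
    (hB : δ ≤ mVal Γ m B)
    (hAB : ∀ a ∈ A, mVal Γ m {b | b ∈ B ∧ b + a ∉ A} ≤ η / (8 * n ^ 2)) :
    ∃ H : AddSubgroup Γ, H.index ≠ 0 ∧ H.index ≤ n ∧ ∀ h ∈ H, defect m A h ≤ 4 ^ n * η := by
  have hn' : (0 : ℝ) < n := by exact_mod_cast hn0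
  refine exists_addSubgroup_le_of_separated (defect_zero hm A) (defect_neg hm A)
    (defect_add_le hm A) hη fun f => ?_
  by_contra! hsep
  have h1 : (n : ℝ) * mVal Γ m B ≤ 1 + n ^ 2 * (1 / (2 * n ^ 2)) := by
    refine hm.card_mul_mVal_le B f (by positivity) fun i j hij => ?_
    have h2 := he.overlap_mul_defect_le hm A (by positivity) hAB (f i - f j)
    have h3 := hsep i j hij
    have h4 := hm.mVal_nonneg {b | b ∈ B ∧ b + (f i - f j) ∈ B}
    have h5 : mVal Γ m {b | b ∈ B ∧ b + (f i - f j) ∈ B} * η ≤ 1 / (2 * n ^ 2) * η := by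
      calc _ ≤ _ := mul_le_mul_of_nonneg_left h3.le h4
        _ ≤ _ := h2
        _ = _ := by field_simp; norm_num
    exact le_of_mul_le_mul_right h5 hη
  have h6 : (n : ℝ) ^ 2 * (1 / (2 * n ^ 2)) = 1 / 2 := by field_simp
  rw [h6] at h1
  nlinarith

/-- The mean of a coset of a finite index subgroup is the reciprocal of the index. -/
lemma IsInvariantMean.mVal_coset (H : AddSubgroup Γ) (hH : H.index ≠ 0) (q : Γ ⧸ H) :
    mVal Γ m {x | (x : Γ ⧸ H) = q} = (H.index : ℝ)⁻¹ := by
  have : Finite (Γ ⧸ H) := Nat.finite_of_card_ne_zero hH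
  have := Fintype.ofFinite (Γ ⧸ H)
  have key : ∀ q' : Γ ⧸ H, mVal Γ m {x | (x : Γ ⧸ H) = q'} = mVal Γ m {x | (x : Γ ⧸ H) = q} := by
    intro q'
    obtain ⟨s, hs⟩ := QuotientAddGroup.mk_surjective (q - q')
    rw [← hm.mVal_shift {x | (x : Γ ⧸ H) = q} s]
    congr 1
    ext x
    simp only [Set.mem_ofPred_eq, QuotientAddGroup.mk_add, hs]
    rw [← eq_sub_iff_add_eq, sub_sub_cancel]
  have h := hm.mVal_eq_sum_fiber (fun x : Γ => (x : Γ ⧸ H)) Set.univ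
  simp only [Set.mem_univ, true_and, key, hm.mVal_univ, Finset.sum_const, Finset.card_univ,
    nsmul_eq_mul] at h
  rw [AddSubgroup.index, Nat.card_eq_fintype_card]
  exact eq_inv_of_mul_eq_one_right h.symm

/-- If `A` is almost invariant under `H`, and contains almost all of `B + a` for `a ∈ A`, then it
contains almost all of `H`. -/
lemma IsExtremeInvariantMean.diff_le_of_almost_period (he : IsExtremeInvariantMean Γ m)
    {A B : Set Γ} (hA : (0 : Γ) ∈ A) {δ ε η θ : ℝ} {n : ℕ} (hδ : 0 < δ) (hη : 0 ≤ η)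
    (hB : δ ≤ mVal Γ m B) (hAB : ∀ a ∈ A, mVal Γ m {b | b ∈ B ∧ b + a ∉ A} ≤ ε)
    {H : AddSubgroup Γ} (hH0 : H.index ≠ 0) (hHn : H.index ≤ n) (hH : ∀ h ∈ H, defect m A h ≤ η)
    (hε : 2 * n * ε ≤ δ) (hθ : 2 * n * η ≤ δ * θ) (hθn : n * θ < 1) :
    mVal Γ m {x | x ∈ H ∧ x ∉ A} ≤ θ := by
  have : Finite (Γ ⧸ H) := Nat.finite_of_card_ne_zero hH0
  have := Fintype.ofFinite (Γ ⧸ H)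
  have hn : (0 : ℝ) < n := by exact_mod_cast (Nat.pos_of_ne_zero hH0).trans_le hHn
  have hcard : (Fintype.card (Γ ⧸ H) : ℝ) ≤ n := by
    rw [← Nat.card_eq_fintype_card]; exact_mod_cast hHn
  obtain ⟨q, hq⟩ : ∃ q : Γ ⧸ H, δ / n ≤ mVal Γ m {x | x ∈ B ∧ (x : Γ ⧸ H) = q} := by
    by_contra! hcon
    have h1 := hm.mVal_eq_sum_fiber (fun x : Γ => (x : Γ ⧸ H)) B
    have h2 := Finset.sum_lt_sum_of_nonempty (s := Finset.univ) Finset.univ_nonempty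
      fun q _ => hcon q
    rw [← h1, Finset.sum_const, Finset.card_univ, nsmul_eq_mul] at h2
    have h3 : (Fintype.card (Γ ⧸ H) : ℝ) * (δ / n) ≤ n * (δ / n) := by gcongr
    have h4 : (n : ℝ) * (δ / n) = δ := by field_simp
    linarith
  have hstep : ∀ a ∈ A, mVal Γ m {x | x ∉ A ∧ (x : Γ ⧸ H) = q + (a : Γ ⧸ H)} ≤ θ := by
    intro a ha
    have h1 : mVal Γ m {x | x ∈ B ∧ (x : Γ ⧸ H) = q} ≤ mVal Γ m {b | b ∈ B ∧ b + a ∉ A} +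
        mVal Γ m {x | x + a ∈ {y | y ∈ A ∧ (y : Γ ⧸ H) = q + (a : Γ ⧸ H)}} := by
      refine hm.mVal_le_add fun x hx => ?_
      simp only [Set.mem_union, Set.mem_ofPred_eq, QuotientAddGroup.mk_add, add_left_inj] at hx ⊢
      tauto
    rw [hm.mVal_shift] at h1
    have h2 := he.coset_dichotomy hm A hη hH (q + (a : Γ ⧸ H))
    have h3 := hAB a ha
    have h4 : ε ≤ δ / n / 2 := by
      rw [div_div, le_div_iff₀ (by positivity)]; linarith
    have h5 : δ / n / 2 ≤ mVal Γ m {y | y ∈ A ∧ (y : Γ ⧸ H) = q + (a : Γ ⧸ H)} := by linarith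
    have h6 := hm.mVal_nonneg {x | x ∉ A ∧ (x : Γ ⧸ H) = q + (a : Γ ⧸ H)}
    have h7 : mVal Γ m {x | x ∉ A ∧ (x : Γ ⧸ H) = q + (a : Γ ⧸ H)} * (δ / n / 2) ≤
        θ * (δ / n / 2) := by
      refine (mul_le_mul_of_nonneg_left h5 h6).trans (h2.trans ?_)
      rw [div_div, ← mul_div_assoc, le_div_iff₀ (by positivity)]
      linarith
    exact le_of_mul_le_mul_right h7 (by positivity)
  have hall : ∀ k : ℕ, mVal Γ m {x | x ∉ A ∧ (x : Γ ⧸ H) = (k + 1) • q} ≤ θ := by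
    intro k
    induction k with
    | zero => simpa using hstep 0 hA
    | succ k ih =>
      obtain ⟨a, ha, haq⟩ : ∃ a ∈ A, (a : Γ ⧸ H) = (k + 1) • q := by
        by_contra! hcon
        have h1 : {x | x ∉ A ∧ (x : Γ ⧸ H) = (k + 1) • q} = {x : Γ | (x : Γ ⧸ H) = (k + 1) • q} := by
          ext x
          simp only [Set.mem_ofPred_eq, and_iff_right_iff_imp]
          exact fun hx hxA => hcon x hxA hx
        rw [h1, hm.mVal_coset H hH0] at ih
        have h2 : (n : ℝ)⁻¹ ≤ (H.index : ℝ)⁻¹ := by gcongr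
        have h3 : (n : ℝ) * (n : ℝ)⁻¹ = 1 := mul_inv_cancel₀ hn.ne'
        nlinarith
      have := hstep a ha
      rwa [haq, ← succ_nsmul'] at this
  obtain ⟨k, hk⟩ : ∃ k : ℕ, (k + 1) • q = 0 := by
    have h1 := addOrderOf_pos q
    refine ⟨addOrderOf q - 1, ?_⟩
    rw [Nat.sub_add_cancel h1, addOrderOf_nsmul_eq_zero]
  have := hall k
  rw [hk] at this
  convert this using 3
  ext x
  simp [QuotientAddGroup.eq_zero_iff, and_comm]

/-- Iterating the Dyson `e`-transform, a pair of sets with small sumset can be replaced by one that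
almost cannot be transformed any further. -/
lemma exists_dyson_minimal {A B C : Set Γ} (hA : (0 : Γ) ∈ A) (hB : (0 : Γ) ∈ B)
    (hC : ∀ a ∈ A, ∀ b ∈ B, a + b ∈ C) {δ : ℝ}
    (hδ : mVal Γ m C + δ ≤ mVal Γ m A + mVal Γ m B) {ε : ℝ} (hε : 0 < ε) :
    ∃ A' B' : Set Γ, (0 : Γ) ∈ A' ∧ A' ⊆ C ∧ δ ≤ mVal Γ m B' ∧
      ∀ a ∈ A', mVal Γ m {b | b ∈ B' ∧ b + a ∉ A'} ≤ ε := by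
  let P : Set Γ → Set Γ → Prop := fun A B => (0 : Γ) ∈ A ∧ (0 : Γ) ∈ B ∧
    (∀ a ∈ A, ∀ b ∈ B, a + b ∈ C) ∧ mVal Γ m C + δ ≤ mVal Γ m A + mVal Γ m B
  let S : Set ℝ := {x | ∃ A B, P A B ∧ mVal Γ m B = x}
  have hSne : S.Nonempty := ⟨_, A, B, ⟨hA, hB, hC, hδ⟩, rfl⟩
  have hSbdd : BddBelow S := ⟨0, by rintro _ ⟨A, B, -, rfl⟩; exact hm.mVal_nonneg B⟩
  obtain ⟨_, ⟨A', B', ⟨h0A, h0B, hsum, hsize⟩, rfl⟩, hlt⟩ := Real.lt_sInf_add_pos hSne hε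
  have hAC : A' ⊆ C := fun a ha => by simpa using hsum a ha 0 h0B
  refine ⟨A', B', h0A, hAC, by linarith [hm.mVal_mono hAC], fun a ha => ?_⟩
  have htrans : P (A' ∪ {x | x + -a ∈ B'}) (B' ∩ {x | x + a ∈ A'}) := by
    refine ⟨Or.inl h0A, ⟨h0B, by simpa using ha⟩, ?_, ?_⟩
    · rintro x (hx | hx) y ⟨hy, hy'⟩
      · exact hsum x hx y hy
      · have := hsum _ hy' _ hx
        convert this using 1
        abel
    · have h1 := hm.mVal_union_add_inter A' {x | x + -a ∈ B'}
      rw [hm.mVal_shift, ← hm.mVal_shift (A' ∩ _) a] at h1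
      have h2 : {x | x + a ∈ A' ∩ {x | x + -a ∈ B'}} = B' ∩ {x | x + a ∈ A'} := by
        ext x
        simp [and_comm]
      rw [h2] at h1
      linarith
  have h3 : sInf S ≤ mVal Γ m (B' ∩ {x | x + a ∈ A'}) := csInf_le hSbdd ⟨_, _, htrans, rfl⟩
  have h4 := hm.mVal_inter_add_diff B' {x | x + a ∈ A'}
  have h5 : B' \ {x | x + a ∈ A'} = {b | b ∈ B' ∧ b + a ∉ A'} := rfl
  rw [h5] at h4
  linarith

/-- A small sumset contains almost all of a coset of a subgroup of bounded index around each of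
its elements. -/
lemma IsExtremeInvariantMean.exists_coset_diff_le (he : IsExtremeInvariantMean Γ m)
    {A B : Set Γ} {δ : ℝ} (hδ0 : 0 < δ)
    (hδ : mVal Γ m (A + B) + δ ≤ mVal Γ m A + mVal Γ m B) {n : ℕ} (hn : 2 ≤ n * δ)
    {c : Γ} (hc : c ∈ A + B) {θ : ℝ} (hθ : 0 < θ) :
    ∃ H : AddSubgroup Γ, H.index ≠ 0 ∧ H.index ≤ n ∧
      mVal Γ m {x | (x : Γ ⧸ H) = c ∧ x ∉ A + B} ≤ θ := by
  obtain ⟨a, ha, b, hb, rfl⟩ := Set.mem_add.1 hc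
  have hn0 : 0 < n := by
    rcases Nat.eq_zero_or_pos n with rfl | h
    · norm_num at hn
    · exact h
  have hn' : (0 : ℝ) < n := by exact_mod_cast hn0
  set θ' := min θ (1 / (2 * n)) with hθ'
  have hθ0 : 0 < θ' := by positivity
  set η := min (δ * θ' / (2 * n * 4 ^ n)) (4 * n * δ) with hη
  have hη0 : 0 < η := by positivity
  obtain ⟨A', B', h0, hAC, hB', hAB⟩ := exists_dyson_minimal hm
    (A := {x | x + a ∈ A}) (B := {x | x + b ∈ B}) (C := {x | x + (a + b) ∈ A + B})
    (by simpa using ha) (by simpa using hb)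
    (fun x hx y hy => by
      simp only [Set.mem_ofPred_eq] at *
      rw [add_add_add_comm]
      exact Set.add_mem_add hx hy) (δ := δ)
    (by rw [hm.mVal_shift, hm.mVal_shift, hm.mVal_shift]; exact hδ)
    (ε := η / (8 * n ^ 2)) (by positivity)
  obtain ⟨H, hH0, hHn, hH⟩ := he.exists_almost_period hm hη0 hn hn0 hB' hAB
  refine ⟨H, hH0, hHn, ?_⟩
  have hmain := he.diff_le_of_almost_period hm h0 (θ := θ') hδ0 (by positivity) hB' hAB hH0 hHn hH
    (by
      have : η ≤ 4 * n * δ := min_le_right _ _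
      rw [← mul_div_assoc, div_le_iff₀ (by positivity)]
      nlinarith)
    (by
      have : η ≤ δ * θ' / (2 * n * 4 ^ n) := min_le_left _ _
      rw [le_div_iff₀ (by positivity)] at this
      linarith)
    (by
      have : θ' ≤ 1 / (2 * n) := min_le_right _ _
      rw [le_div_iff₀ (by positivity)] at this
      linarith)
  refine le_trans ?_ (hmain.trans (min_le_left _ _))
  rw [← hm.mVal_shift _ (a + b)]
  refine hm.mVal_mono fun x hx => ?_
  simp only [Set.mem_ofPred_eq, QuotientAddGroup.mk_add] at hx ⊢
  refine ⟨(QuotientAddGroup.eq_zero_iff x).1 (by simpa using hx.1), fun hxA => hx.2 (hAC hxA)⟩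

end Local

omit [TopologicalSpace Γ] [DiscreteTopology Γ] in
lemma finite_addSubgroups_ge {K : AddSubgroup Γ} (hK : K.index ≠ 0) :
    {J : AddSubgroup Γ | K ≤ J}.Finite := by
  have : Finite (Γ ⧸ K) := Nat.finite_of_card_ne_zero hK
  refine (Set.finite_range fun L : AddSubgroup (Γ ⧸ K) =>
    L.comap (QuotientAddGroup.mk' K)).subset fun J hJ => ?_
  refine ⟨J.map (QuotientAddGroup.mk' K), AddSubgroup.comap_map_eq_self ?_⟩
  rwa [QuotientAddGroup.ker_mk']

omit [TopologicalSpace Γ] [DiscreteTopology Γ] in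
/-- In an infinite family of subgroups of bounded index, some subgroup contains infinitely many
members, while none of its proper subgroups does. -/
lemma exists_minimal_infinite_le {𝓗 : Set (AddSubgroup Γ)} (h𝓗 : 𝓗.Infinite) {n : ℕ}
    (hidx : ∀ H ∈ 𝓗, H.index ≠ 0 ∧ H.index ≤ n) :
    ∃ J : AddSubgroup Γ, J.index ≠ 0 ∧ {H ∈ 𝓗 | H < J}.Infinite ∧
      ∀ J' < J, {H ∈ 𝓗 | H ≤ J'}.Finite := by
  have hle : ∀ J : AddSubgroup Γ, {H ∈ 𝓗 | H ≤ J}.Infinite → J.index ≠ 0 ∧ J.index ≤ n := by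
    intro J hJ
    obtain ⟨H, hH, hHJ⟩ := hJ.nonempty
    have h1 := AddSubgroup.index_dvd_of_le hHJ
    exact ⟨ne_zero_of_dvd_ne_zero (hidx H hH).1 h1,
      (Nat.le_of_dvd (Nat.pos_of_ne_zero (hidx H hH).1) h1).trans (hidx H hH).2⟩
  obtain ⟨J, hJ, hmin⟩ := (measure fun J : AddSubgroup Γ => n - J.index).wf.has_min
    {J : AddSubgroup Γ | {H ∈ 𝓗 | H ≤ J}.Infinite} ⟨⊤, by simpa using h𝓗⟩
  refine ⟨J, (hle J hJ).1, fun hfin => hJ ?_, fun J' hJ' => ?_⟩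
  · refine (hfin.union (Set.finite_singleton J)).subset fun H hH => ?_
    rcases hH.2.lt_or_eq with h | h
    · exact Or.inl ⟨hH.1, h⟩
    · exact Or.inr h
  · by_contra hinf
    have h1 := hle J' hinf
    have : J'.FiniteIndex := ⟨h1.1⟩
    have h2 := AddSubgroup.index_strictAnti hJ'
    refine hmin J' hinf ?_
    change n - J'.index < n - J.index
    omega

section Cosets

variable {m : BoundedContinuousFunction Γ ℝ →ₗ[ℝ] ℝ} (hm : IsInvariantMean Γ m)
include hm

/-- If `D` is `K`-periodic inside a coset of `J = K ⊔ H`, then every coset of `H` inside this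
coset of `J` carries the same proportion of `D`. -/
lemma IsInvariantMean.mVal_le_index_mul {J K H : AddSubgroup Γ} (hKH : K ⊔ H = J)
    (hH : H.index ≠ 0) {D : Set Γ} {c : Γ} (hD : ∀ d ∈ D, (d : Γ ⧸ J) = c)
    (hK : ∀ d ∈ D, ∀ k ∈ K, d + k ∈ D) :
    mVal Γ m D ≤ H.index * mVal Γ m {x | x ∈ D ∧ (x : Γ ⧸ H) = c} := by
  have : Finite (Γ ⧸ H) := Nat.finite_of_card_ne_zero hH
  have := Fintype.ofFinite (Γ ⧸ H)
  have key : ∀ q : Γ ⧸ H, mVal Γ m {x | x ∈ D ∧ (x : Γ ⧸ H) = q} ≤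
      mVal Γ m {x | x ∈ D ∧ (x : Γ ⧸ H) = c} := by
    intro q
    rcases Set.eq_empty_or_nonempty {x | x ∈ D ∧ (x : Γ ⧸ H) = q} with he | ⟨d, hd, rfl⟩
    · rw [he, hm.mVal_empty]
      exact hm.mVal_nonneg _
    · have h1 : -c + d ∈ K ⊔ H := by
        rw [hKH, ← QuotientAddGroup.eq, hD d hd]
      obtain ⟨k, hk, h, hh, hkh⟩ := AddSubgroup.mem_sup.1 h1
      rw [← hm.mVal_shift {x | x ∈ D ∧ (x : Γ ⧸ H) = c} (-k)]
      refine hm.mVal_mono fun x hx => ⟨hK x hx.1 _ (K.neg_mem hk), ?_⟩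
      have h2 := hx.2
      rw [eq_comm, QuotientAddGroup.eq] at h2 ⊢
      have h3 : -c + (x + -k) = h + (-d + x) := by
        have hd' : d = c + (k + h) := by rw [hkh, add_neg_cancel_left]
        rw [hd']
        abel
      rw [h3]
      exact H.add_mem hh h2
  rw [hm.mVal_eq_sum_fiber (fun x : Γ => (x : Γ ⧸ H)) D]
  refine (Finset.sum_le_sum fun q _ => key q).trans_eq ?_
  rw [Finset.sum_const, Finset.card_univ, nsmul_eq_mul, AddSubgroup.index,
    Nat.card_eq_fintype_card]

/-- If `C` almost contains cosets of infinitely many subgroups of bounded index, then one of these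
cosets can be enlarged to a coset of a larger subgroup that is contained in `C` up to a null
set. -/
lemma IsInvariantMean.exists_larger_coset (C : Set Γ) {𝓗 : Set (AddSubgroup Γ)}
    (h𝓗 : 𝓗.Infinite) {n : ℕ} (hidx : ∀ H ∈ 𝓗, H.index ≠ 0 ∧ H.index ≤ n)
    (x : AddSubgroup Γ → Γ)
    (htol : ∀ ε > 0, {H ∈ 𝓗 | ε < mVal Γ m {y | (y : Γ ⧸ H) = x H ∧ y ∉ C}}.Finite) :
    ∃ H ∈ 𝓗, ∃ J, H < J ∧ mVal Γ m {y | (y : Γ ⧸ J) = x H ∧ y ∉ C} = 0 := by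
  obtain ⟨J, hJ0, hJinf, hJfin⟩ := exists_minimal_infinite_le h𝓗 hidx
  have : Finite (Γ ⧸ J) := Nat.finite_of_card_ne_zero hJ0
  obtain ⟨z, hz⟩ : ∃ z : Γ ⧸ J, {H ∈ 𝓗 | H < J ∧ (x H : Γ ⧸ J) = z}.Infinite := by
    by_contra! hcon
    refine hJinf ((Set.finite_iUnion fun z => hcon z).subset fun H hH => ?_)
    exact Set.mem_iUnion.2 ⟨(x H : Γ ⧸ J), hH.1, hH.2, rfl⟩
  obtain ⟨H₀, hH₀, hH₀J, rfl⟩ := hz.nonempty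
  refine ⟨H₀, hH₀, J, hH₀J, ?_⟩
  have hn : 0 < n := (Nat.pos_of_ne_zero (hidx H₀ hH₀).1).trans_le (hidx H₀ hH₀).2
  have hn' : (1 : ℝ) ≤ n := by exact_mod_cast hn
  have key : ∀ k : ℕ, ∀ ε > 0, ∃ (K : AddSubgroup Γ) (D : Set Γ), K.index ≠ 0 ∧ K ≤ J ∧
      (∀ d ∈ D, (d : Γ ⧸ J) = x H₀) ∧ (∀ d ∈ D, ∀ k ∈ K, d + k ∈ D) ∧
      mVal Γ m {y | ((y : Γ ⧸ J) = x H₀ ∧ y ∉ C) ∧ y ∉ D} ≤ ε ∧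
      mVal Γ m D ≤ (1 - 1 / n) ^ k := by
    intro k
    induction k with
    | zero =>
      intro ε hε
      refine ⟨J, {y | (y : Γ ⧸ J) = x H₀}, hJ0, le_rfl, fun d hd => hd, fun d hd k hk => ?_, ?_, ?_⟩
      · have hk' : ((k : Γ) : Γ ⧸ J) = 0 := (QuotientAddGroup.eq_zero_iff k).2 hk
        simp only [Set.mem_ofPred_eq, QuotientAddGroup.mk_add] at hd ⊢
        rw [hd, hk', add_zero]
      · have hempty : {y : Γ | ((y : Γ ⧸ J) = x H₀ ∧ y ∉ C) ∧
            y ∉ {y : Γ | (y : Γ ⧸ J) = x H₀}} = ∅ :=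
          Set.eq_empty_of_forall_notMem fun y hy => hy.2 hy.1.1
        rw [hempty, hm.mVal_empty]
        exact hε.le
      · simpa using hm.mVal_le_one _
    | succ k ih =>
      intro ε hε
      obtain ⟨K, D, hK0, hKJ, hDJ, hDK, hDε, hDk⟩ := ih (ε / 2) (by positivity)
      have hbad : (⋃ J' ∈ {J' : AddSubgroup Γ | K ≤ J' ∧ J' < J}, {H ∈ 𝓗 | H ≤ J'}).Finite :=
        Set.Finite.biUnion ((finite_addSubgroups_ge hK0).subset fun J' h => h.1)
          fun J' h => hJfin J' h.2
      obtain ⟨H, ⟨hH, hHJ, hHz⟩, hHbad⟩ :=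
        (hz.sdiff (hbad.union (htol (ε / 2) (by positivity)))).nonempty
      simp only [Set.mem_union, not_or] at hHbad
      obtain ⟨hHbad, hHtol⟩ := hHbad
      have hHtol' : mVal Γ m {y | (y : Γ ⧸ H) = x H ∧ y ∉ C} ≤ ε / 2 := by
        by_contra! h
        exact hHtol ⟨hH, h⟩
      have hsup : K ⊔ H = J := by
        by_contra hne
        exact hHbad (Set.mem_biUnion (x := K ⊔ H)
          ⟨le_sup_left, (sup_le hKJ hHJ.le).lt_of_ne hne⟩ ⟨hH, le_sup_right⟩)
      have hprop := hm.mVal_le_index_mul hsup (hidx H hH).1 (c := x H)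
        (fun d hd => (hDJ d hd).trans hHz.symm) hDK
      have hsplit := hm.mVal_inter_add_diff D {y | (y : Γ ⧸ H) = x H}
      have hDnn := hm.mVal_nonneg {y | y ∈ D ∧ (y : Γ ⧸ H) = x H}
      refine ⟨K ⊓ H, D \ {y | (y : Γ ⧸ H) = x H}, AddSubgroup.index_inf_ne_zero hK0 (hidx H hH).1,
        inf_le_left.trans hKJ, fun d hd => hDJ d hd.1, ?_, ?_, ?_⟩
      · rintro d ⟨hd, hdH⟩ k ⟨hkK, hkH⟩
        refine ⟨hDK d hd k hkK, fun h => hdH ?_⟩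
        have hk' : ((k : Γ) : Γ ⧸ H) = 0 := (QuotientAddGroup.eq_zero_iff k).2 hkH
        simp only [Set.mem_ofPred_eq, QuotientAddGroup.mk_add] at h ⊢
        rwa [hk', add_zero] at h
      · have := hm.mVal_le_add (A := {y | ((y : Γ ⧸ J) = x H₀ ∧ y ∉ C) ∧
          y ∉ D \ {y | (y : Γ ⧸ H) = x H}}) (B := {y | ((y : Γ ⧸ J) = x H₀ ∧ y ∉ C) ∧ y ∉ D})
          (C := {y | (y : Γ ⧸ H) = x H ∧ y ∉ C}) (fun y hy => by
            simp only [Set.mem_union, Set.mem_ofPred_eq, Set.mem_sdiff] at hy ⊢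
            tauto)
        linarith
      · have h1 : mVal Γ m D ≤ n * mVal Γ m {y | y ∈ D ∧ (y : Γ ⧸ H) = x H} := by
          refine hprop.trans (mul_le_mul_of_nonneg_right ?_ hDnn)
          exact_mod_cast (hidx H hH).2
        have h2 : mVal Γ m D / n ≤ mVal Γ m {y | y ∈ D ∧ (y : Γ ⧸ H) = x H} := by
          rw [div_le_iff₀ (by positivity)]
          linarith
        have h3 : D ∩ {y | (y : Γ ⧸ H) = x H} = {y | y ∈ D ∧ (y : Γ ⧸ H) = x H} := rfl
        rw [h3] at hsplit
        have h4 : (0 : ℝ) ≤ 1 - 1 / n := by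
          rw [sub_nonneg, div_le_one (by positivity)]
          exact hn'
        calc _ ≤ (1 - 1 / (n : ℝ)) * mVal Γ m D := by
              rw [sub_mul, one_mul, one_div_mul_eq_div]
              linarith
          _ ≤ (1 - 1 / (n : ℝ)) * (1 - 1 / n) ^ k := mul_le_mul_of_nonneg_left hDk h4
          _ = _ := (pow_succ' _ _).symm
  refine le_antisymm (le_of_forall_pos_le_add fun ε hε => ?_) (hm.mVal_nonneg _)
  obtain ⟨k, hk⟩ := exists_pow_lt_of_lt_one (half_pos hε) (y := 1 - 1 / (n : ℝ)) (by
    have : (0 : ℝ) < 1 / n := by positivity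
    linarith)
  obtain ⟨K, D, -, -, -, -, h1, h2⟩ := key k (ε / 2) (half_pos hε)
  have := hm.mVal_le_add (A := {y | (y : Γ ⧸ J) = x H₀ ∧ y ∉ C})
    (B := {y | ((y : Γ ⧸ J) = x H₀ ∧ y ∉ C) ∧ y ∉ D}) (C := D) (fun y hy => by
      simp only [Set.mem_union, Set.mem_ofPred_eq] at hy ⊢
      tauto)
  linarith

/-- If `C` almost contains, around a point, cosets of subgroups of bounded index with arbitrarily
small error, then it contains such a coset up to a null set. -/
lemma IsInvariantMean.exists_coset_diff_eq_zero (C : Set Γ) {n : ℕ} (c : Γ)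
    (hC : ∀ θ > 0, ∃ H : AddSubgroup Γ, H.index ≠ 0 ∧ H.index ≤ n ∧
      mVal Γ m {x | (x : Γ ⧸ H) = c ∧ x ∉ C} ≤ θ) :
    ∃ H : AddSubgroup Γ, H.index ≠ 0 ∧ H.index ≤ n ∧
      mVal Γ m {x | (x : Γ ⧸ H) = c ∧ x ∉ C} = 0 := by
  choose H hH0 hHn hH using fun k : ℕ => hC (1 / (k + 1)) Nat.one_div_pos_of_nat
  by_cases hfin : (Set.range H).Finite
  · by_contra! hcon
    have hpos : ∀ L ∈ Set.range H, 0 < mVal Γ m {x | (x : Γ ⧸ L) = c ∧ x ∉ C} := by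
      rintro _ ⟨k, rfl⟩
      exact (hm.mVal_nonneg _).lt_of_ne' (hcon _ (hH0 k) (hHn k))
    obtain ⟨L, hL, hmin⟩ := Set.exists_min_image (Set.range H)
      (fun L => mVal Γ m {x | (x : Γ ⧸ L) = c ∧ x ∉ C}) hfin (Set.range_nonempty H)
    obtain ⟨k, hk⟩ := exists_nat_one_div_lt (hpos L hL)
    exact absurd ((hmin (H k) ⟨k, rfl⟩).trans (hH k)) (not_le.2 hk)
  · obtain ⟨_, ⟨k, rfl⟩, J, hlt, hJ⟩ := hm.exists_larger_coset C (n := n) (Set.not_finite.1 hfin)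
      (by rintro _ ⟨k, rfl⟩; exact ⟨hH0 k, hHn k⟩) (fun _ => c) (fun ε hε => by
        obtain ⟨N, hN⟩ := exists_nat_one_div_lt hε
        refine ((Set.finite_Iio N).image H).subset ?_
        rintro _ ⟨⟨k, rfl⟩, hk⟩
        refine ⟨k, ?_, rfl⟩
        by_contra! hNk
        have h1 : (1 : ℝ) / (k + 1) ≤ 1 / (N + 1) := by
          have : (N : ℝ) ≤ k := by exact_mod_cast not_lt.1 hNk
          gcongr
        linarith [hH k])
    have h1 := AddSubgroup.index_dvd_of_le hlt.le
    exact ⟨J, ne_zero_of_dvd_ne_zero (hH0 k) h1,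
      (Nat.le_of_dvd (Nat.pos_of_ne_zero (hH0 k)) h1).trans (hHn k), hJ⟩

/-- All invariant means agree on periodic sets. -/
lemma IsInvariantMean.mVal_eq_of_periodic {p : BoundedContinuousFunction Γ ℝ →ₗ[ℝ] ℝ}
    (hp : IsInvariantMean Γ p) {K : AddSubgroup Γ} (hK : K.index ≠ 0) {E : Set Γ}
    (hE : ∀ e ∈ E, ∀ k ∈ K, e + k ∈ E) : mVal Γ p E = mVal Γ m E := by
  have : Finite (Γ ⧸ K) := Nat.finite_of_card_ne_zero hK
  have := Fintype.ofFinite (Γ ⧸ K)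
  rw [hp.mVal_eq_sum_fiber (fun x : Γ => (x : Γ ⧸ K)),
    hm.mVal_eq_sum_fiber (fun x : Γ => (x : Γ ⧸ K))]
  refine Finset.sum_congr rfl fun q _ => ?_
  rcases Set.eq_empty_or_nonempty {x | x ∈ E ∧ (x : Γ ⧸ K) = q} with he | ⟨e, he, rfl⟩
  · rw [he, hp.mVal_empty, hm.mVal_empty]
  · have : {x | x ∈ E ∧ (x : Γ ⧸ K) = e} = {x : Γ | (x : Γ ⧸ K) = e} := by
      ext x
      simp only [Set.mem_ofPred_eq, and_iff_right_iff_imp]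
      intro hx
      have := hE e he _ (QuotientAddGroup.eq.1 hx.symm)
      rwa [add_neg_cancel_left] at this
    rw [this, hp.mVal_coset K hK, hm.mVal_coset K hK]

/-- If `C` contains, up to null sets, a coset of a subgroup of bounded index around each of its
points, then no invariant mean of `C` exceeds the given one. -/
lemma IsInvariantMean.mVal_le_of_cosets (C : Set Γ) {n : ℕ}
    (hC : ∀ c ∈ C, ∃ H : AddSubgroup Γ, H.index ≠ 0 ∧ H.index ≤ n ∧
      mVal Γ m {x | (x : Γ ⧸ H) = c ∧ x ∉ C} = 0)
    {p : BoundedContinuousFunction Γ ℝ →ₗ[ℝ] ℝ} (hp : IsInvariantMean Γ p) :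
    mVal Γ p C ≤ mVal Γ m C := by
  have hmin : ∀ c ∈ C, ∃ H : AddSubgroup Γ, (H.index ≠ 0 ∧ H.index ≤ n ∧
      mVal Γ m {x | (x : Γ ⧸ H) = c ∧ x ∉ C} = 0) ∧
      ∀ J, H < J → mVal Γ m {x | (x : Γ ⧸ J) = c ∧ x ∉ C} ≠ 0 := by
    intro c hc
    obtain ⟨H, hH, hHmin⟩ := (measure fun H : AddSubgroup Γ => H.index).wf.has_min
      {H | H.index ≠ 0 ∧ H.index ≤ n ∧ mVal Γ m {x | (x : Γ ⧸ H) = c ∧ x ∉ C} = 0} (hC c hc)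
    refine ⟨H, hH, fun J hJ h0 => ?_⟩
    have : H.FiniteIndex := ⟨hH.1⟩
    have h1 := AddSubgroup.index_strictAnti hJ
    have h2 := AddSubgroup.index_dvd_of_le hJ.le
    exact hHmin J ⟨ne_zero_of_dvd_ne_zero hH.1 h2, h1.le.trans hH.2.1, h0⟩ h1
  choose! H hH hHmax using hmin
  have hfin : (H '' C).Finite := by
    by_contra hinf
    have hx : ∀ L ∈ H '' C, ∃ c ∈ C, H c = L := fun L hL => hL
    choose! x hxC hxH using hx
    obtain ⟨L, hL, J, hLJ, hJ⟩ := hm.exists_larger_coset C (Set.not_finite.1 hinf) (n := n)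
      (by rintro _ ⟨c, hc, rfl⟩; exact ⟨(hH c hc).1, (hH c hc).2.1⟩) x (fun ε hε => by
        convert Set.finite_empty
        refine Set.eq_empty_of_forall_notMem ?_
        rintro L ⟨hL, hlt⟩
        have := (hH (x L) (hxC L hL)).2.2
        rw [hxH L hL] at this
        linarith)
    refine hHmax (x L) (hxC L hL) J ?_ hJ
    rwa [hxH L hL]
  have := hfin.to_subtype
  set K : AddSubgroup Γ := ⨅ L : H '' C, (L : AddSubgroup Γ) with hKdef
  have hK : K.index ≠ 0 := by
    have : K.FiniteIndex := AddSubgroup.finiteIndex_iInf (by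
      rintro ⟨_, c, hc, rfl⟩
      exact ⟨(hH c hc).1⟩)
    exact this.index_ne_zero
  have hKH : ∀ c ∈ C, K ≤ H c := fun c hc => iInf_le (fun L : H '' C => (L : AddSubgroup Γ))
    ⟨H c, c, hc, rfl⟩
  set E : Set Γ := {x | ∃ c ∈ C, (x : Γ ⧸ H c) = c} with hE
  have hEper : ∀ e ∈ E, ∀ k ∈ K, e + k ∈ E := by
    rintro e ⟨c, hc, he⟩ k hk
    refine ⟨c, hc, ?_⟩
    rw [QuotientAddGroup.mk_add, he, (QuotientAddGroup.eq_zero_iff k).2 (hKH c hc hk), add_zero]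
  have hEC : mVal Γ m (E \ C) = 0 := by
    have : Finite (Γ ⧸ K) := Nat.finite_of_card_ne_zero hK
    have := Fintype.ofFinite (Γ ⧸ K)
    rw [hm.mVal_eq_sum_fiber (fun x : Γ => (x : Γ ⧸ K))]
    refine Finset.sum_eq_zero fun q _ => le_antisymm ?_ (hm.mVal_nonneg _)
    rcases Set.eq_empty_or_nonempty {x | x ∈ E \ C ∧ (x : Γ ⧸ K) = q} with he | ⟨e, he, rfl⟩
    · rw [he, hm.mVal_empty]
    · obtain ⟨c, hc, hec⟩ := he.1
      rw [← (hH c hc).2.2]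
      refine hm.mVal_mono fun x hx => ⟨?_, hx.1.2⟩
      rw [← hec, QuotientAddGroup.eq]
      exact hKH c hc (QuotientAddGroup.eq.1 hx.2)
  calc mVal Γ p C ≤ mVal Γ p E := hp.mVal_mono fun c hc => ⟨c, hc, rfl⟩
    _ = mVal Γ m E := hm.mVal_eq_of_periodic hp hK hEper
    _ ≤ mVal Γ m C + mVal Γ m (E \ C) := hm.mVal_le_add fun x hx => by
        by_cases h : x ∈ C
        · exact Or.inl h
        · exact Or.inr ⟨hx, h⟩
    _ = mVal Γ m C := by rw [hEC, add_zero]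

/-- Every linear functional `m ↦ m f` on invariant means is maximized at an extreme point. -/
lemma IsInvariantMean.exists_extreme_ge (f : BoundedContinuousFunction Γ ℝ) :
    ∃ ν, IsInvariantMean Γ ν ∧ IsExtremeInvariantMean Γ ν ∧ m f ≤ ν f := by
  set S : Set (BoundedContinuousFunction Γ ℝ → ℝ) := {φ | ∃ ν, IsInvariantMean Γ ν ∧ ⇑ν = φ}
    with hS
  have hclosed : IsClosed S := by
    have : S = Set.range ((↑) : (BoundedContinuousFunction Γ ℝ →ₗ[ℝ] ℝ) → _) ∩
        ({φ | φ 1 = 1} ∩ ((⋂ g : {g : BoundedContinuousFunction Γ ℝ // ∀ x, 0 ≤ g x},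
          {φ | 0 ≤ φ g}) ∩ ⋂ γ : Γ, ⋂ g, {φ | φ (translate Γ γ g) = φ g})) := by
      ext φ
      constructor
      · rintro ⟨ν, hν, rfl⟩
        exact ⟨⟨ν, rfl⟩, hν.map_one, Set.mem_iInter.2 fun g => hν.nonneg g g.2,
          Set.mem_iInter.2 fun γ => Set.mem_iInter.2 fun g => hν.invariant γ g⟩
      · rintro ⟨⟨ν, rfl⟩, h1, h2, h3⟩
        exact ⟨ν, ⟨h1, fun g hg => Set.mem_iInter.1 h2 ⟨g, hg⟩,
          fun γ g => Set.mem_iInter.1 (Set.mem_iInter.1 h3 γ) g⟩, rfl⟩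
    rw [this]
    refine LinearMap.isClosed_range_coe _ _ _ |>.inter
      ((isClosed_eq (continuous_apply _) continuous_const).inter
        ((isClosed_iInter fun g => isClosed_le continuous_const (continuous_apply _)).inter
          (isClosed_iInter fun γ => isClosed_iInter fun g =>
            isClosed_eq (continuous_apply _) (continuous_apply _))))
  have hcompact : IsCompact S := by
    refine (isCompact_univ_pi fun g : BoundedContinuousFunction Γ ℝ =>
      isCompact_Icc (a := -‖g‖) (b := ‖g‖)).of_isClosed_subset hclosed ?_
    rintro _ ⟨ν, hν, rfl⟩ g -
    exact _root_.abs_le.1 (hν.abs_le g)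
  set l : (BoundedContinuousFunction Γ ℝ → ℝ) →L[ℝ] ℝ := ContinuousLinearMap.proj f
  set F : Set (BoundedContinuousFunction Γ ℝ → ℝ) := {φ ∈ S | ∀ ψ ∈ S, l ψ ≤ l φ} with hF
  have hexp : IsExposed ℝ S F := fun _ => ⟨l, rfl⟩
  have hne : F.Nonempty := by
    obtain ⟨φ, hφ, hmax⟩ := hcompact.exists_isMaxOn ⟨_, m, hm, rfl⟩ l.continuous.continuousOn
    exact ⟨φ, hφ, fun ψ hψ => hmax hψ⟩
  obtain ⟨φ, hφ⟩ := (hexp.isCompact hcompact).extremePoints_nonempty hne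
  have hφS := hexp.isExtreme.extremePoints_subset_extremePoints hφ
  obtain ⟨⟨⟨ν, hν, rfl⟩, hmax⟩, -⟩ := hφ
  refine ⟨ν, hν, ⟨hν, fun m₁ h₁ m₂ h₂ hseg => ?_⟩, hmax _ ⟨m, hm, rfl⟩⟩
  obtain ⟨a, b, ha, hb, hab, rfl⟩ := hseg
  exact DFunLike.coe_injective (hφS.2 ⟨m₁, h₁, rfl⟩ ⟨m₂, h₂, rfl⟩ ⟨a, b, ha, hb, hab, rfl⟩)

lemma IsInvariantMean.mVal_le_ubd (A : Set Γ) : mVal Γ m A ≤ ubd Γ A :=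
  le_csSup ⟨1, by rintro _ ⟨ν, hν, rfl⟩; exact hν.mVal_le_one A⟩ ⟨m, hm, rfl⟩

end Cosets

end Helpers

theorem ubd_gap_of_mean_gap (A B : Set Γ) (hA : A.Nonempty) (hB : B.Nonempty)
    (m : BoundedContinuousFunction Γ ℝ →ₗ[ℝ] ℝ) (hm : IsInvariantMean Γ m)
    (h : mVal Γ m (A + B) < mVal Γ m A + mVal Γ m B) :
    ubd Γ (A + B) < ubd Γ A + ubd Γ B := by
  obtain ⟨ν, hν, he, hle⟩ := hm.exists_extreme_ge (ind Γ A + ind Γ B - ind Γ (A + B))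
  simp only [map_add, map_sub] at hle
  simp only [mVal] at h
  obtain ⟨δ, hδ, hgap⟩ : ∃ δ > 0, mVal Γ ν (A + B) + δ ≤ mVal Γ ν A + mVal Γ ν B :=
    ⟨ν (ind Γ A) + ν (ind Γ B) - ν (ind Γ (A + B)), by linarith, by simp only [mVal]; linarith⟩
  obtain ⟨n, hn⟩ := exists_nat_ge (2 / δ)
  rw [div_le_iff₀ hδ] at hn
  have hcoset := fun c (hc : c ∈ A + B) => hν.exists_coset_diff_eq_zero (A + B) c
    fun θ hθ => he.exists_coset_diff_le hν hδ hgap hn hc hθ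
  have hubd : ubd Γ (A + B) ≤ mVal Γ ν (A + B) := by
    refine csSup_le ⟨_, ν, hν, rfl⟩ ?_
    rintro _ ⟨p, hp, rfl⟩
    exact hν.mVal_le_of_cosets (A + B) hcoset hp
  linarith [hν.mVal_le_ubd A, hν.mVal_le_ubd B]

end SumsetMeans
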